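/- arXiv:2605.20943 — 2 statements merged into one kernel-verified Lean document; each statement's English description precedes it below -/
import Mathlib

section
/- Let G^cm be a cm-C-DMG over a partition of the substantive variables into nonempty clusters, let C be a cluster containing at least one partially observed variable, and let R_C be its cluster-level missingness vertex. Assume there exists at least one variable-level m-ADMG compatible with G^cm. Then C and R_C are adjacent in G^cm (joined by a directed or bidirected edge) if and only if there exists a variable-level m-ADMG compatible with G^cm in which some partially observed variable X ∈ C is adjacent to its own missingness indicator R_X. -/
/-- Vertices of a variable-level missingness graph (m-ADMG): substantive
variables, missingness indicators, and proxy variables. -/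
inductive MVert (ι : Type) where
  | var (x : ι)
  | ind (x : ι)
  | proxy (x : ι)
  deriving DecidableEq

/-- A vertex "exists" in an m-ADMG with partially observed set `Vm`:
indicators and proxies only exist for partially observed variables. -/
def MVert.ok {ι : Type} (Vm : Set ι) : MVert ι → Prop
  | .var _ => True
  | .ind x => x ∈ Vm
  | .proxy x => x ∈ Vm

/-- A variable-level missingness graph (m-ADMG): an acyclic directed mixed graph
over substantive variables `ι`, with a missingness indicator and a proxy for each
partially observed variable (those in `Vm`).  Proxy vertices have no children and
no bidirected edges and have exactly the parents `var x` and `ind x`; missingness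
indicators have no self-loops, no edges between different indicators, and their
only children are their own proxies. -/
structure mADMG (ι : Type) where
  Vm : Set ι
  dir : MVert ι → MVert ι → Prop
  bi : MVert ι → MVert ι → Prop
  acyclic : ∀ v, ¬ Relation.TransGen dir v v
  bi_ne : ∀ u v, bi u v → u ≠ v
  mem_dir : ∀ u v, dir u v → u.ok Vm ∧ v.ok Vm
  mem_bi : ∀ u v, bi u v → u.ok Vm ∧ v.ok Vm
  proxy_no_children : ∀ (x : ι) (v : MVert ι), ¬ dir (.proxy x) v
  proxy_no_bi : ∀ (x : ι) (v : MVert ι), ¬ bi (.proxy x) v ∧ ¬ bi v (.proxy x)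
  proxy_parents : ∀ (x : ι) (v : MVert ι),
    dir v (.proxy x) ↔ (x ∈ Vm ∧ (v = .var x ∨ v = .ind x))
  ind_no_ind_dir : ∀ x y : ι, ¬ dir (.ind x) (.ind y)
  ind_no_ind_bi : ∀ x y : ι, ¬ bi (.ind x) (.ind y)
  ind_children : ∀ (x : ι) (v : MVert ι), dir (.ind x) v → v = .proxy x

/-- Vertices of an m-C-DMG: cluster vertices, variable-level missingness
indicators, and variable-level proxies. -/
inductive CVert (γ ι : Type) where
  | cl (c : γ)
  | ind (x : ι)
  | proxy (x : ι)
  deriving DecidableEq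

/-- Vertices of a cm-C-DMG: cluster vertices, cluster-level missingness
indicators, and variable-level proxies. -/
inductive CMVert (γ ι : Type) where
  | cl (c : γ)
  | rcl (c : γ)
  | proxy (x : ι)
  deriving DecidableEq

/-- An abstract m-C-DMG over clusters `γ` and substantive variables `ι`. -/
structure ClusterM (γ ι : Type) where
  Vm : Set ι
  dir : CVert γ ι → CVert γ ι → Prop
  bi : CVert γ ι → CVert γ ι → Prop

/-- An abstract cm-C-DMG over clusters `γ` and substantive variables `ι`. -/
structure ClusterCM (γ ι : Type) where
  Vm : Set ι
  dir : CMVert γ ι → CMVert γ ι → Prop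
  bi : CMVert γ ι → CMVert γ ι → Prop

variable {ι γ : Type}

/-- Directed edges of the m-C-DMG induced by an m-ADMG `G` and cluster map `κ`. -/
def inducedMdir (G : mADMG ι) (κ : ι → γ) : CVert γ ι → CVert γ ι → Prop
  | .cl c, .cl d => ∃ x y, κ x = c ∧ κ y = d ∧ G.dir (.var x) (.var y)
  | .cl c, .ind y => ∃ x, κ x = c ∧ G.dir (.var x) (.ind y)
  | .cl c, .proxy x => κ x = c ∧ x ∈ G.Vm
  | .ind x, .proxy y => x = y ∧ x ∈ G.Vm
  | _, _ => False

/-- Bidirected edges of the m-C-DMG induced by an m-ADMG `G` and cluster map `κ`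
(bidirected edges are unordered, so both recorded orientations are used). -/
def inducedMbi (G : mADMG ι) (κ : ι → γ) : CVert γ ι → CVert γ ι → Prop
  | .cl c, .cl d => ∃ x y, κ x = c ∧ κ y = d ∧
      (G.bi (.var x) (.var y) ∨ G.bi (.var y) (.var x))
  | .cl c, .ind y => ∃ x, κ x = c ∧ (G.bi (.var x) (.ind y) ∨ G.bi (.ind y) (.var x))
  | .ind y, .cl c => ∃ x, κ x = c ∧ (G.bi (.var x) (.ind y) ∨ G.bi (.ind y) (.var x))
  | _, _ => False

/-- The m-C-DMG induced by an m-ADMG `G` under the cluster map `κ`. -/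
def inducedM (G : mADMG ι) (κ : ι → γ) : ClusterM γ ι :=
  ⟨G.Vm, inducedMdir G κ, inducedMbi G κ⟩

/-- Directed edges of the cm-C-DMG induced by an m-ADMG `G` and cluster map `κ`. -/
def inducedCMdir (G : mADMG ι) (κ : ι → γ) : CMVert γ ι → CMVert γ ι → Prop
  | .cl c, .cl d => ∃ x y, κ x = c ∧ κ y = d ∧ G.dir (.var x) (.var y)
  | .cl c, .rcl d => ∃ x y, κ x = c ∧ κ y = d ∧ G.dir (.var x) (.ind y)
  | .cl c, .proxy x => κ x = c ∧ x ∈ G.Vm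
  | .rcl d, .proxy x => κ x = d ∧ x ∈ G.Vm
  | _, _ => False

/-- Bidirected edges of the cm-C-DMG induced by an m-ADMG `G` and cluster map `κ`. -/
def inducedCMbi (G : mADMG ι) (κ : ι → γ) : CMVert γ ι → CMVert γ ι → Prop
  | .cl c, .cl d => ∃ x y, κ x = c ∧ κ y = d ∧
      (G.bi (.var x) (.var y) ∨ G.bi (.var y) (.var x))
  | .cl c, .rcl d => ∃ x y, κ x = c ∧ κ y = d ∧
      (G.bi (.var x) (.ind y) ∨ G.bi (.ind y) (.var x))
  | .rcl d, .cl c => ∃ x y, κ x = c ∧ κ y = d ∧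
      (G.bi (.var x) (.ind y) ∨ G.bi (.ind y) (.var x))
  | _, _ => False

/-- The cm-C-DMG induced by an m-ADMG `G` under the cluster map `κ`. -/
def inducedCM (G : mADMG ι) (κ : ι → γ) : ClusterCM γ ι :=
  ⟨G.Vm, inducedCMdir G κ, inducedCMbi G κ⟩

/-- The vertex map underlying `π`: merge each variable-level missingness
indicator `R_X` into the cluster-level missingness vertex `R_{κ X}`. -/
def mergeVert (κ : ι → γ) : CVert γ ι → CMVert γ ι
  | .cl c => .cl c
  | .ind x => .rcl (κ x)
  | .proxy x => .proxy x

/-- The abstraction map `π` sending an m-C-DMG to its associated cm-C-DMG: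
within each cluster all missingness indicators are merged into a single
cluster-level missingness vertex, edges following along. -/
def piMap (κ : ι → γ) (H : ClusterM γ ι) : ClusterCM γ ι :=
  ⟨H.Vm,
   fun a b => ∃ u v, mergeVert κ u = a ∧ mergeVert κ v = b ∧ H.dir u v,
   fun a b => ∃ u v, mergeVert κ u = a ∧ mergeVert κ v = b ∧ H.bi u v⟩

/-- Adjacency (neighborhood) in a cm-C-DMG: joined by a directed or bidirected
edge, regardless of type or orientation. -/
def ClusterCM.adj {γ ι : Type} (H : ClusterCM γ ι) (a b : CMVert γ ι) : Prop :=
  H.dir a b ∨ H.dir b a ∨ H.bi a b ∨ H.bi b a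

/-- Adjacency (neighborhood) in an m-ADMG: joined by a directed or bidirected
edge, regardless of type or orientation. -/
def mADMG.adj {ι : Type} (G : mADMG ι) (a b : MVert ι) : Prop :=
  G.dir a b ∨ G.dir b a ∨ G.bi a b ∨ G.bi b a



theorem aux_trans (G : mADMG ι) (x0 : ι) (u v : MVert ι)
    (h : Relation.TransGen (fun u v => G.dir u v ∨ (u = .var x0 ∧ v = .ind x0)) u v) :
    ∀ y, v = .var y → Relation.TransGen G.dir u v := by
  induction h with
  | single h =>
    rintro y rfl
    rcases h with h | ⟨_, h⟩
    · exact .single h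
    · cases h
  | @tail b d _ h ih =>
    rintro y rfl
    rcases h with h | ⟨_, h⟩
    · cases b with
      | var z => exact (ih z rfl).tail h
      | ind z => have := G.ind_children _ _ h; cases this
      | proxy z => exact (G.proxy_no_children _ _ h).elim
    · cases h

def addDir (G : mADMG ι) (x0 : ι) (hx : x0 ∈ G.Vm) : mADMG ι where
  Vm := G.Vm
  dir u v := G.dir u v ∨ (u = .var x0 ∧ v = .ind x0)
  bi := G.bi
  acyclic v h := by
    cases v with
    | var y => exact G.acyclic _ (aux_trans G x0 _ _ h y rfl)
    | ind y =>
      obtain ⟨w, h1, h2⟩ := Relation.TransGen.head'_iff.1 h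
      have hw : w = .proxy y := by
        rcases h1 with h1 | ⟨h1, _⟩
        · exact G.ind_children _ _ h1
        · cases h1
      subst hw
      rcases Relation.ReflTransGen.cases_head h2 with h2 | ⟨w, h2 | ⟨h2, _⟩, _⟩
      · cases h2
      · exact G.proxy_no_children _ _ h2
      · cases h2
    | proxy y =>
      obtain ⟨w, h2 | ⟨h2, _⟩, _⟩ := Relation.TransGen.head'_iff.1 h
      · exact G.proxy_no_children _ _ h2
      · cases h2
  bi_ne := G.bi_ne
  mem_dir u v h := by
    rcases h with h | ⟨rfl, rfl⟩
    · exact G.mem_dir _ _ h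
    · exact ⟨trivial, hx⟩
  mem_bi := G.mem_bi
  proxy_no_children x v h := by
    rcases h with h | ⟨h, _⟩
    · exact G.proxy_no_children _ _ h
    · cases h
  proxy_no_bi := G.proxy_no_bi
  proxy_parents x v := by simp [G.proxy_parents]
  ind_no_ind_dir x y := by simp [G.ind_no_ind_dir]
  ind_no_ind_bi := G.ind_no_ind_bi
  ind_children x v h := by
    rcases h with h | ⟨h, _⟩
    · exact G.ind_children _ _ h
    · cases h

def addBi (G : mADMG ι) (x0 : ι) (hx : x0 ∈ G.Vm) : mADMG ι where
  Vm := G.Vm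
  dir := G.dir
  bi u v := G.bi u v ∨ (u = .var x0 ∧ v = .ind x0)
  acyclic := G.acyclic
  bi_ne u v h := by
    rcases h with h | ⟨rfl, rfl⟩
    · exact G.bi_ne _ _ h
    · simp
  mem_dir := G.mem_dir
  mem_bi u v h := by
    rcases h with h | ⟨rfl, rfl⟩
    · exact G.mem_bi _ _ h
    · exact ⟨trivial, hx⟩
  proxy_no_children := G.proxy_no_children
  proxy_no_bi x v := by simp [G.proxy_no_bi]
  proxy_parents := G.proxy_parents
  ind_no_ind_dir := G.ind_no_ind_dir
  ind_no_ind_bi x y := by simp [G.ind_no_ind_bi]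
  ind_children := G.ind_children

theorem addDir_induced (G : mADMG ι) (κ : ι → γ) (x0 : ι) (hx : x0 ∈ G.Vm)
    (h : inducedCMdir G κ (.cl (κ x0)) (.rcl (κ x0))) :
    inducedCM (addDir G x0 hx) κ = inducedCM G κ := by
  have h1 : inducedCMdir (addDir G x0 hx) κ = inducedCMdir G κ := by
    funext a b
    apply propext
    cases a <;> cases b <;> simp only [inducedCMdir, addDir] <;> try simp
    constructor
    · rintro ⟨x, rfl, y, rfl, h' | ⟨rfl, rfl⟩⟩
      · exact ⟨x, rfl, y, rfl, h'⟩
      · obtain ⟨x, y, hx, hy, h⟩ := h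
        exact ⟨x, hx, y, hy, h⟩
    · rintro ⟨x, rfl, y, rfl, h'⟩
      exact ⟨x, rfl, y, rfl, .inl h'⟩
  have h2 : inducedCMbi (addDir G x0 hx) κ = inducedCMbi G κ := by
    funext a b
    cases a <;> cases b <;> rfl
  unfold inducedCM
  rw [h1, h2]
  rfl

theorem addBi_induced (G : mADMG ι) (κ : ι → γ) (x0 : ι) (hx : x0 ∈ G.Vm)
    (h : inducedCMbi G κ (.cl (κ x0)) (.rcl (κ x0))) :
    inducedCM (addBi G x0 hx) κ = inducedCM G κ := by
  have h1 : inducedCMdir (addBi G x0 hx) κ = inducedCMdir G κ := by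
    funext a b
    cases a <;> cases b <;> rfl
  have key : ∀ c d, (∃ x y, κ x = c ∧ κ y = d ∧
      ((addBi G x0 hx).bi (.var x) (.ind y) ∨ (addBi G x0 hx).bi (.ind y) (.var x))) ↔
      (∃ x y, κ x = c ∧ κ y = d ∧ (G.bi (.var x) (.ind y) ∨ G.bi (.ind y) (.var x))) := by
    intro c d
    constructor
    · rintro ⟨x, y, rfl, rfl, (h' | ⟨h1, h2⟩) | (h' | ⟨h1, h2⟩)⟩
      · exact ⟨x, y, rfl, rfl, .inl h'⟩
      · cases h1; cases h2; exact h
      · exact ⟨x, y, rfl, rfl, .inr h'⟩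
      · cases h1
    · rintro ⟨x, y, rfl, rfl, h' | h'⟩
      · exact ⟨x, y, rfl, rfl, .inl (.inl h')⟩
      · exact ⟨x, y, rfl, rfl, .inr (.inl h')⟩
  have h2 : inducedCMbi (addBi G x0 hx) κ = inducedCMbi G κ := by
    funext a b
    apply propext
    cases a <;> cases b <;> first | exact key _ _ | simp [inducedCMbi, addBi]
  unfold inducedCM
  rw [h1, h2]
  rfl

/-- Let `Gcm` be a cm-C-DMG over a partition into nonempty
clusters (`κ` surjective), `c` a cluster containing a partially observed
variable, and assume some m-ADMG is compatible with `Gcm`.  Then `c` and its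
cluster-level missingness vertex `R_c` are adjacent in `Gcm` iff there exists an
m-ADMG compatible with `Gcm` in which some partially observed variable `x` of
the cluster `c` is adjacent to its own missingness indicator `R_x`. -/
theorem cluster_adj_iff_exists_compatible_adj {ι γ : Type} (κ : ι → γ)
    (hκ : Function.Surjective κ) (Gcm : ClusterCM γ ι)
    (c : γ) (hc : ∃ x ∈ Gcm.Vm, κ x = c)
    (hex : ∃ G : mADMG ι, inducedCM G κ = Gcm) :
    Gcm.adj (.cl c) (.rcl c) ↔
      ∃ G : mADMG ι, inducedCM G κ = Gcm ∧
        ∃ x ∈ Gcm.Vm, κ x = c ∧ G.adj (.var x) (.ind x) := by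
  obtain ⟨G, rfl⟩ := hex
  constructor
  · obtain ⟨x, hx, rfl⟩ := hc
    have hD : inducedCMdir G κ (.cl (κ x)) (.rcl (κ x)) → _ := fun h =>
      (⟨addDir G x hx, addDir_induced G κ x hx h, x, hx, rfl, .inl (.inr ⟨rfl, rfl⟩)⟩ :
        ∃ G' : mADMG ι, inducedCM G' κ = inducedCM G κ ∧
        ∃ y ∈ (inducedCM G κ).Vm, κ y = κ x ∧ G'.adj (.var y) (.ind y))
    have hB : inducedCMbi G κ (.cl (κ x)) (.rcl (κ x)) → _ := fun h =>
      (⟨addBi G x hx, addBi_induced G κ x hx h, x, hx, rfl,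
        .inr (.inr (.inl (.inr ⟨rfl, rfl⟩)))⟩ :
        ∃ G' : mADMG ι, inducedCM G' κ = inducedCM G κ ∧
        ∃ y ∈ (inducedCM G κ).Vm, κ y = κ x ∧ G'.adj (.var y) (.ind y))
    rintro (h | h | h | h)
    · exact hD h
    · exact h.elim
    · exact hB h
    · exact hB h
  · rintro ⟨G', hG, x, hx, rfl, h⟩
    rw [← hG]
    rcases h with h | h | h | h
    · exact .inl ⟨x, x, rfl, rfl, h⟩
    · have := G'.ind_children _ _ h
      cases this
    · exact .inr (.inr (.inl ⟨x, x, rfl, rfl, .inl h⟩))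
    · exact .inr (.inr (.inl ⟨x, x, rfl, rfl, .inr h⟩))
end

section
/- Let (Ω, ℱ, P) be a probability space, α and β measurable spaces, V_m : Ω → α and V_o : Ω → β measurable random variables, and R : Ω → Bool a measurable missingness indicator. Suppose R and V_m are conditionally independent given the σ-algebra generated by V_o (the MAR condition), and let V_m* : Ω → α be a measurable function with V_m*(ω) = V_m(ω) for every ω with R(ω) = 0 (the proxy consistency condition). Then for every measurable set A ⊆ α and every b ∈ β such that {b} is measurable and P(V_o = b, R = 0) > 0, the joint distribution factorizes through observable quantities: P(V_m ∈ A, V_o = b) = P(V_m* ∈ A | V_o = b, R = 0) · P(V_o = b). -/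
open MeasureTheory ProbabilityTheory

lemma mar_aux {Ω : Type*} [mΩ : MeasurableSpace Ω] (P : Measure Ω) [IsProbabilityMeasure P]
    {β : Type*} [mβ : MeasurableSpace β] (Vo : Ω → β) (hVo : Measurable Vo)
    (b : β) (hb : MeasurableSet ({b} : Set β)) (s : Set Ω) (hs : MeasurableSet s)
    (w : Ω) (hw : Vo w = b) :
    (P⟦s | MeasurableSpace.comap Vo mβ⟧) w * P.real {ω | Vo ω = b}
      = P.real (s ∩ {ω | Vo ω = b}) := by
  set f := P⟦s | MeasurableSpace.comap Vo mβ⟧ with hf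
  have hfm : Measurable[MeasurableSpace.comap Vo mβ] f := stronglyMeasurable_condExp.measurable
  have hconst : ∀ x ∈ {ω | Vo ω = b}, f x = f w := by
    intro x hx
    obtain ⟨t, -, ht⟩ := hfm (measurableSet_singleton (f w))
    have h1 : w ∈ Vo ⁻¹' t := by rw [ht]; simp
    have h2 : x ∈ Vo ⁻¹' t := by
      have hx' : Vo x = b := hx
      simpa [Set.mem_preimage, hx', hw] using h1
    rw [ht] at h2
    simpa using h2
  have hB : MeasurableSet[MeasurableSpace.comap Vo mβ] {ω | Vo ω = b} := ⟨{b}, hb, rfl⟩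
  have hBm : MeasurableSet {ω | Vo ω = b} := hVo.comap_le _ hB
  have hint : Integrable (s.indicator (fun _ => (1 : ℝ))) P :=
    (integrable_const 1).indicator hs
  have h := setIntegral_condExp (μ := P) hVo.comap_le hint hB
  rw [setIntegral_congr_fun hBm hconst, integral_indicator_const _ hs] at h
  simp only [setIntegral_const, smul_eq_mul, mul_one] at h
  rw [measureReal_restrict_apply hs] at h
  rw [mul_comm]; exact h

/-- MAR: the joint distribution factorizes through observable
quantities.
Let `P` be a probability measure on `Ω`, `Vm : Ω → α` and `Vo : Ω → β`
measurable random variables, and `R : Ω → Bool` a measurable missingness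
indicator (with `R ω = false` meaning "observed").  Suppose `R` and `Vm` are
conditionally independent given the σ-algebra generated by `Vo` (MAR), and
`Vm⋆` is a measurable proxy for `Vm`, i.e. `Vm⋆ ω = Vm ω` whenever
`R ω = false`.  Then for every measurable `A ⊆ α` and every `b : β` with `{b}`
measurable and `P(Vo = b, R = 0) > 0`,
`P(Vm ∈ A, Vo = b) = P(Vm⋆ ∈ A | Vo = b, R = 0) ⬝ P(Vo = b)`. -/
theorem mar_joint_factorization {Ω : Type*} [mΩ : MeasurableSpace Ω]
    [StandardBorelSpace Ω] [Nonempty Ω] (P : Measure Ω) [IsProbabilityMeasure P]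
    {α β : Type*} [MeasurableSpace α] [MeasurableSpace β]
    (Vm Vmstar : Ω → α) (Vo : Ω → β) (R : Ω → Bool)
    (hVm : Measurable Vm) (hVmstar : Measurable Vmstar) (hVo : Measurable Vo)
    (hR : Measurable R)
    (hMAR : CondIndepFun (MeasurableSpace.comap Vo inferInstance) hVo.comap_le
      R Vm P)
    (hproxy : ∀ ω, R ω = false → Vmstar ω = Vm ω)
    (A : Set α) (hA : MeasurableSet A)
    (b : β) (hb : MeasurableSet ({b} : Set β))
    (hpos : 0 < P ({ω | Vo ω = b} ∩ {ω | R ω = false})) :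
    P (Vm ⁻¹' A ∩ {ω | Vo ω = b}) =
      ProbabilityTheory.cond P ({ω | Vo ω = b} ∩ {ω | R ω = false})
          (Vmstar ⁻¹' A) * P {ω | Vo ω = b} := by
  set B := {ω | Vo ω = b} with hBdef
  set Z := {ω | R ω = false} with hZdef
  have hZ : MeasurableSet Z := hR (measurableSet_singleton false)
  have hB : MeasurableSet B := hVo hb
  have hPB : P B ≠ 0 := fun h => hpos.ne' (measure_mono_null Set.inter_subset_left h)
  have hci := (condIndepFun_iff _ _ R Vm hR hVm P).1 hMAR Z (Vm ⁻¹' A)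
    ⟨{false}, measurableSet_singleton false, rfl⟩ ⟨A, hA, rfl⟩
  obtain ⟨w, hwB, hw⟩ : ∃ w ∈ B, _ :=
    ((frequently_ae_mem_iff.2 hPB).and_eventually hci).exists
  have e1 := mar_aux P Vo hVo b hb _ (hZ.inter (hVm hA)) w hwB
  have e2 := mar_aux P Vo hVo b hb _ hZ w hwB
  have e3 := mar_aux P Vo hVo b hb _ (hVm hA) w hwB
  rw [hw, Pi.mul_apply] at e1
  have key : P.real (Z ∩ Vm ⁻¹' A ∩ B) * P.real B = P.real (Z ∩ B) * P.real (Vm ⁻¹' A ∩ B) := by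
    rw [← e1, ← e2, ← e3]; ring
  have key' : P (Z ∩ Vm ⁻¹' A ∩ B) * P B = P (Z ∩ B) * P (Vm ⁻¹' A ∩ B) := by
    rw [← ENNReal.toReal_eq_toReal_iff' (by finiteness) (by finiteness)]
    simpa [Measure.real, ENNReal.toReal_mul] using key
  have hset : B ∩ Z ∩ Vmstar ⁻¹' A = Z ∩ Vm ⁻¹' A ∩ B := by
    ext ω
    simp only [Set.mem_inter_iff, Set.mem_preimage]
    constructor
    · rintro ⟨⟨h1, h2⟩, h3⟩
      exact ⟨⟨h2, by rwa [← hproxy ω h2]⟩, h1⟩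
    · rintro ⟨⟨h2, h3⟩, h1⟩
      exact ⟨⟨h1, h2⟩, by rwa [hproxy ω h2]⟩
  rw [cond_apply (hB.inter hZ), hset, mul_assoc, key', Set.inter_comm Z B, ← mul_assoc,
    ENNReal.inv_mul_cancel hpos.ne' (by finiteness), one_mul]
end
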